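/- Let n and k be integers with 1 ≤ k < n and k odd, and let w : (0,∞) → ℝ be measurable satisfying ∫₀^∞ s^{n−k−1} |w(s)| ds < ∞, ∫₁^∞ s^{β+n−k−1} |w(s)| ds < ∞ for some β > k, and the cancellation conditions ∫₀^∞ s^{j+n−k−1} w(s) ds = 0 for j = 0, 2, 4, …, 2⌊k/2⌋. Define w̃(s) = s^{(n−k)/2 − 1} w(√s) and λ(s) = (1/(s Γ(k/2 + 1))) ∫₀^{s²} (s² − r)^{k/2} w̃(r) dr for s > 0. Then λ is integrable on (0,∞) and ∫₀^∞ λ(s) ds = Γ(−k/2) ∫₀^∞ s^{n−1} w(s) ds. -/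

import Mathlib

open MeasureTheory

/-- The Taylor coefficients at `0` of `v ↦ (1 - v) ^ (M - 1 / 2)`, up to degree `M - 1`. -/
noncomputable def halfBinomCoeff : ℕ → ℕ → ℝ
  | _, 0 => 1
  | 0, _ + 1 => 0
  | M + 1, j + 1 => -((M : ℝ) + 1 / 2) / (j + 1) * halfBinomCoeff M j

/-- The truncated power `(1 - v)₊ ^ (M - 1 / 2)` minus its Taylor polynomial of degree `M - 1`
at `0`. -/
noncomputable def halfPowRem (M : ℕ) (v : ℝ) : ℝ :=
  max (1 - v) 0 ^ ((M : ℝ) - 1 / 2) - ∑ j ∈ Finset.range M, halfBinomCoeff M j * v ^ j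

lemma measurable_halfPowRem (M : ℕ) : Measurable (halfPowRem M) := by
  unfold halfPowRem
  fun_prop

lemma continuous_halfPowRem_succ (M : ℕ) : Continuous (halfPowRem (M + 1)) := by
  have h : (0 : ℝ) ≤ ((M + 1 : ℕ) : ℝ) - 1 / 2 := by
    push_cast
    linarith [(Nat.cast_nonneg M : (0 : ℝ) ≤ M)]
  refine Continuous.sub (Continuous.rpow_const (by fun_prop) fun _ => Or.inr h) (by fun_prop)

lemma halfPowRem_succ_zero (M : ℕ) : halfPowRem (M + 1) 0 = 0 := by
  simp [halfPowRem, Finset.sum_range_succ', halfBinomCoeff]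

lemma hasDerivAt_halfPowRem_succ (M : ℕ) {v : ℝ} (hv : v ≠ 1) :
    HasDerivAt (halfPowRem (M + 1)) (-((M : ℝ) + 1 / 2) * halfPowRem M v) v := by
  have hM : (0 : ℝ) ≤ M := Nat.cast_nonneg M
  have hpoly : HasDerivAt
      (fun x : ℝ => ∑ j ∈ Finset.range (M + 1), halfBinomCoeff (M + 1) j * x ^ j)
      (-((M : ℝ) + 1 / 2) * ∑ j ∈ Finset.range M, halfBinomCoeff M j * v ^ j) v := by
    simp only [Finset.sum_range_succ', halfBinomCoeff, pow_zero, mul_one]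
    refine HasDerivAt.add_const _ ?_
    rw [Finset.mul_sum]
    refine HasDerivAt.fun_sum fun j _ => ?_
    convert! (hasDerivAt_pow (j + 1) v).const_mul
      (-((M : ℝ) + 1 / 2) / (j + 1) * halfBinomCoeff M j) using 1
    push_cast
    field_simp
  have hpow : HasDerivAt (fun x : ℝ => max (1 - x) 0 ^ (((M + 1 : ℕ) : ℝ) - 1 / 2))
      (-((M : ℝ) + 1 / 2) * max (1 - v) 0 ^ ((M : ℝ) - 1 / 2)) v := by
    rcases lt_or_gt_of_ne hv with h | h
    · have h1 : HasDerivAt (fun x : ℝ => (1 - x) ^ (((M + 1 : ℕ) : ℝ) - 1 / 2))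
          (-((M : ℝ) + 1 / 2) * (1 - v) ^ ((M : ℝ) - 1 / 2)) v := by
        convert! ((hasDerivAt_id v).const_sub 1).rpow_const (p := ((M + 1 : ℕ) : ℝ) - 1 / 2)
          (Or.inl (by simp only [id]; linarith)) using 1
        push_cast
        simp only [id]
        rw [show (M : ℝ) + 1 - 1 / 2 - 1 = M - 1 / 2 by ring]
        ring
      rw [max_eq_left (by linarith)]
      refine h1.congr_of_eventuallyEq ?_
      filter_upwards [Iio_mem_nhds h] with x hx
      rw [max_eq_left (by linarith [Set.mem_Iio.1 hx])]
    · rw [max_eq_right (by linarith), Real.zero_rpow (by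
        intro h0
        have h2 : (2 * M : ℝ) = (1 : ℕ) := by push_cast; linarith
        norm_cast at h2
        omega), mul_zero]
      refine (hasDerivAt_const v (0 : ℝ)).congr_of_eventuallyEq ?_
      filter_upwards [Ioi_mem_nhds h] with x hx
      rw [max_eq_right (by linarith [Set.mem_Ioi.1 hx]), Real.zero_rpow (by push_cast; linarith)]
  unfold halfPowRem
  rw [mul_sub]
  exact hpow.sub hpoly

lemma exists_abs_halfPowRem_succ_le_of_le_one (M : ℕ) :
    ∃ C : ℝ, 0 ≤ C ∧ ∀ v : ℝ, 0 ≤ v → v ≤ 1 → |halfPowRem (M + 1) v| ≤ C * v ^ (M + 1) := by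
  induction M with
  | zero =>
    refine ⟨1, zero_le_one, fun v h0 h1 => ?_⟩
    have h2 : 0 ≤ 1 - v := by linarith
    have h3 : halfPowRem (0 + 1) v = √(1 - v) - 1 := by
      rw [Real.sqrt_eq_rpow]
      norm_num [halfPowRem, halfBinomCoeff, h1]
    have h4 := Real.sq_sqrt h2
    have h5 := Real.sqrt_nonneg (1 - v)
    have h6 : √(1 - v) ≤ 1 := Real.sqrt_le_one.2 (by linarith)
    rw [h3, abs_le, zero_add, pow_one, one_mul]
    constructor <;> nlinarith
  | succ M ih =>
    obtain ⟨C, hC, h⟩ := ih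
    refine ⟨((M + 1 : ℕ) + 1 / 2 : ℝ) * C, by positivity, fun v h0 h1 => ?_⟩
    have hmv := norm_image_sub_le_of_norm_deriv_right_le_segment
      (f' := fun x => -(((M + 1 : ℕ) : ℝ) + 1 / 2) * halfPowRem (M + 1) x)
      (C := ((M + 1 : ℕ) + 1 / 2 : ℝ) * (C * v ^ (M + 1)))
      (continuous_halfPowRem_succ (M + 1)).continuousOn
      (fun x hx => (hasDerivAt_halfPowRem_succ (M + 1)
        (hx.2.trans_le h1).ne).hasDerivWithinAt)
      (fun x hx => by
        rw [norm_mul, norm_neg, Real.norm_of_nonneg (by positivity), Real.norm_eq_abs]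
        have hx0 := hx.1
        have hxv := hx.2.le
        refine mul_le_mul_of_nonneg_left ((h x hx0 (hxv.trans h1)).trans ?_) (by positivity)
        gcongr) v ⟨h0, le_rfl⟩
    rw [halfPowRem_succ_zero, sub_zero, sub_zero, Real.norm_eq_abs] at hmv
    exact hmv.trans_eq (by ring)

lemma exists_abs_halfPowRem_succ_le_of_one_le (M : ℕ) :
    ∃ C : ℝ, 0 ≤ C ∧ ∀ v : ℝ, 1 ≤ v → |halfPowRem (M + 1) v| ≤ C * v ^ M := by
  refine ⟨∑ j ∈ Finset.range (M + 1), |halfBinomCoeff (M + 1) j|, by positivity, fun v hv => ?_⟩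
  rw [halfPowRem, max_eq_right (by linarith), Real.zero_rpow (by
    have : (0 : ℝ) ≤ M := Nat.cast_nonneg M
    push_cast
    linarith), zero_sub, abs_neg, Finset.sum_mul]
  refine (Finset.abs_sum_le_sum_abs _ _).trans (Finset.sum_le_sum fun j hj => ?_)
  rw [abs_mul, abs_of_nonneg (by positivity : 0 ≤ v ^ j)]
  gcongr
  exact Nat.lt_succ_iff.1 (Finset.mem_range.1 hj)

lemma integrableOn_and_integral_rpow_mul_halfPowRem_zero :
    IntegrableOn (fun v : ℝ => v ^ (-((0 : ℕ) : ℝ) - 1 / 2) * halfPowRem 0 v) (Set.Ioi 0) ∧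
    ∫ v in Set.Ioi 0, v ^ (-((0 : ℕ) : ℝ) - 1 / 2) * halfPowRem 0 v =
      Real.Gamma (1 / 2 - ((0 : ℕ) : ℝ)) * Real.Gamma ((0 : ℕ) + 1 / 2) := by
  set b : ℝ → ℝ := fun v => v ^ (-((0 : ℕ) : ℝ) - 1 / 2) * halfPowRem 0 v with hb
  have hcongr : ∀ x ∈ Set.Ioo (0 : ℝ) 1,
      ((x : ℂ) ^ (((1 / 2 : ℝ) : ℂ) - 1) * (1 - (x : ℂ)) ^ (((1 / 2 : ℝ) : ℂ) - 1)) = (b x : ℂ) := by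
    intro x hx
    have h1 : 0 ≤ 1 - x := by linarith [hx.2]
    have h2 : max (1 - x) 0 = 1 - x := max_eq_left h1
    rw [hb]
    simp only [halfPowRem, Finset.range_zero, Finset.sum_empty, sub_zero, h2]
    rw [Complex.ofReal_mul, Complex.ofReal_cpow hx.1.le, Complex.ofReal_cpow h1]
    push_cast
    norm_num
  have hzero : ∀ x ∈ Set.Ioi (0 : ℝ) \ Set.Ioo 0 1, b x = 0 := by
    intro x hx
    have h1 : 1 ≤ x := by
      by_contra! h
      exact hx.2 ⟨hx.1, h⟩
    have h2 : max (1 - x) 0 = 0 := max_eq_right (by linarith)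
    simp [hb, halfPowRem, h2, Real.zero_rpow]
  have hint := Complex.betaIntegral_convergent (u := ((1 / 2 : ℝ) : ℂ)) (v := ((1 / 2 : ℝ) : ℂ))
    (by norm_num) (by norm_num)
  rw [intervalIntegrable_iff_integrableOn_Ioo_of_le zero_le_one,
    integrableOn_congr_fun hcongr measurableSet_Ioo] at hint
  have hbint : IntegrableOn b (Set.Ioo 0 1) := by simpa [IntegrableOn] using hint.re
  have hval := Complex.betaIntegral_eq_Gamma_mul_div ((1 / 2 : ℝ) : ℂ) ((1 / 2 : ℝ) : ℂ)
    (by norm_num) (by norm_num)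
  rw [Complex.betaIntegral, intervalIntegral.integral_of_le zero_le_one,
    integral_Ioc_eq_integral_Ioo, setIntegral_congr_fun measurableSet_Ioo hcongr, integral_complex_ofReal, ← Complex.ofReal_add,
    Complex.Gamma_ofReal, Complex.Gamma_ofReal, ← Complex.ofReal_mul, ← Complex.ofReal_div,
    Complex.ofReal_inj] at hval
  refine ⟨hbint.of_forall_sdiff_eq_zero measurableSet_Ioi hzero, ?_⟩
  rw [setIntegral_eq_of_subset_of_forall_sdiff_eq_zero measurableSet_Ioi
    (fun x hx => hx.1) hzero, hval]
  norm_num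

lemma integrableOn_rpow_mul_halfPowRem (M : ℕ) :
    IntegrableOn (fun v : ℝ => v ^ (-(M : ℝ) - 1 / 2) * halfPowRem M v) (Set.Ioi 0) := by
  cases M with
  | zero => exact integrableOn_and_integral_rpow_mul_halfPowRem_zero.1
  | succ M =>
    obtain ⟨C, hC, h⟩ := exists_abs_halfPowRem_succ_le_of_le_one M
    obtain ⟨D, hD, h'⟩ := exists_abs_halfPowRem_succ_le_of_one_le M
    have hmeas : Measurable
        (fun v : ℝ => v ^ (-((M + 1 : ℕ) : ℝ) - 1 / 2) * halfPowRem (M + 1) v) :=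
      (measurable_id.pow_const _).mul (measurable_halfPowRem _)
    rw [← Set.Ioc_union_Ioi_eq_Ioi zero_le_one]
    refine IntegrableOn.union ?_ ?_
    · have hi : IntegrableOn (fun v : ℝ => C * v ^ (-1 / 2 : ℝ)) (Set.Ioc 0 1) :=
        ((intervalIntegrable_iff_integrableOn_Ioc_of_le zero_le_one).1
          (intervalIntegral.intervalIntegrable_rpow' (by norm_num))).const_mul C
      refine hi.mono' hmeas.aestronglyMeasurable
        ((ae_restrict_iff' measurableSet_Ioc).2 (.of_forall fun v hv => ?_))
      rw [norm_mul, Real.norm_of_nonneg (Real.rpow_nonneg hv.1.le _), Real.norm_eq_abs]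
      refine (mul_le_mul_of_nonneg_left (h v hv.1.le hv.2)
        (Real.rpow_nonneg hv.1.le _)).trans_eq ?_
      rw [← Real.rpow_natCast, mul_left_comm, ← Real.rpow_add hv.1]
      ring_nf
    · have hi : IntegrableOn (fun v : ℝ => D * v ^ (-3 / 2 : ℝ)) (Set.Ioi 1) :=
        (integrableOn_Ioi_rpow_of_lt (by norm_num) one_pos).const_mul D
      refine hi.mono' hmeas.aestronglyMeasurable
        ((ae_restrict_iff' measurableSet_Ioi).2 (.of_forall fun v hv => ?_))
      have hv0 : 0 < v := one_pos.trans hv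
      rw [norm_mul, Real.norm_of_nonneg (Real.rpow_nonneg hv0.le _), Real.norm_eq_abs]
      refine (mul_le_mul_of_nonneg_left (h' v (le_of_lt hv))
        (Real.rpow_nonneg hv0.le _)).trans_eq ?_
      rw [← Real.rpow_natCast, mul_left_comm, ← Real.rpow_add hv0]
      push_cast
      ring_nf

lemma hasDerivAt_rpow_mul_halfPowRem_succ (M : ℕ) {v : ℝ} (h0 : 0 < v) (h1 : v ≠ 1) :
    HasDerivAt
      (fun x : ℝ => -((M : ℝ) + 1 / 2)⁻¹ * (x ^ (-((M : ℝ) + 1 / 2)) * halfPowRem (M + 1) x))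
      (v ^ (-((M + 1 : ℕ) : ℝ) - 1 / 2) * halfPowRem (M + 1) v +
        v ^ (-(M : ℝ) - 1 / 2) * halfPowRem M v) v := by
  have hM : (M : ℝ) + 1 / 2 ≠ 0 := by positivity
  convert! ((Real.hasDerivAt_rpow_const (p := -((M : ℝ) + 1 / 2)) (Or.inl h0.ne')).mul
    (hasDerivAt_halfPowRem_succ M h1)).const_mul (-((M : ℝ) + 1 / 2)⁻¹) using 1
  rw [show -((M + 1 : ℕ) : ℝ) - 1 / 2 = -((M : ℝ) + 1 / 2) - 1 by push_cast; ring,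
    show -(M : ℝ) - 1 / 2 = -((M : ℝ) + 1 / 2) by ring]
  field_simp
  ring

lemma tendsto_rpow_mul_halfPowRem_succ_nhdsGT_zero (M : ℕ) :
    Filter.Tendsto (fun x : ℝ => x ^ (-((M : ℝ) + 1 / 2)) * halfPowRem (M + 1) x)
      (nhdsWithin 0 (Set.Ioi 0)) (nhds 0) := by
  obtain ⟨C, hC, h⟩ := exists_abs_halfPowRem_succ_le_of_le_one M
  have hlim : Filter.Tendsto (fun x : ℝ => C * x ^ (1 / 2 : ℝ))
      (nhdsWithin 0 (Set.Ioi 0)) (nhds 0) := by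
    have hc : Continuous (fun x : ℝ => C * x ^ (1 / 2 : ℝ)) :=
      (Real.continuous_rpow_const (by norm_num)).const_mul C
    simpa using (hc.tendsto 0).mono_left nhdsWithin_le_nhds
  refine squeeze_zero_norm' ?_ hlim
  filter_upwards [Ioo_mem_nhdsGT (zero_lt_one' ℝ)] with v hv
  rw [norm_mul, Real.norm_of_nonneg (Real.rpow_nonneg hv.1.le _), Real.norm_eq_abs]
  refine (mul_le_mul_of_nonneg_left (h v hv.1.le hv.2.le)
    (Real.rpow_nonneg hv.1.le _)).trans_eq ?_
  rw [← Real.rpow_natCast, mul_left_comm, ← Real.rpow_add hv.1]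
  push_cast
  ring_nf

lemma tendsto_rpow_mul_halfPowRem_succ_atTop (M : ℕ) :
    Filter.Tendsto (fun x : ℝ => x ^ (-((M : ℝ) + 1 / 2)) * halfPowRem (M + 1) x)
      Filter.atTop (nhds 0) := by
  obtain ⟨D, hD, h⟩ := exists_abs_halfPowRem_succ_le_of_one_le M
  have hlim : Filter.Tendsto (fun x : ℝ => D * x ^ (-(1 / 2) : ℝ)) Filter.atTop (nhds 0) := by
    simpa using (tendsto_rpow_neg_atTop (y := 1 / 2) (by norm_num)).const_mul D
  refine squeeze_zero_norm' ?_ hlim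
  filter_upwards [Filter.eventually_ge_atTop 1] with v hv
  have hv0 : 0 < v := one_pos.trans_le hv
  rw [norm_mul, Real.norm_of_nonneg (Real.rpow_nonneg hv0.le _), Real.norm_eq_abs]
  refine (mul_le_mul_of_nonneg_left (h v hv) (Real.rpow_nonneg hv0.le _)).trans_eq ?_
  rw [← Real.rpow_natCast, mul_left_comm, ← Real.rpow_add hv0]
  ring_nf

lemma integral_rpow_mul_halfPowRem_succ (M : ℕ) :
    ∫ v in Set.Ioi (0 : ℝ), v ^ (-((M + 1 : ℕ) : ℝ) - 1 / 2) * halfPowRem (M + 1) v =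
      -∫ v in Set.Ioi (0 : ℝ), v ^ (-(M : ℝ) - 1 / 2) * halfPowRem M v := by
  have hi := (integrableOn_rpow_mul_halfPowRem (M + 1)).add (integrableOn_rpow_mul_halfPowRem M)
  set F : ℝ → ℝ :=
    fun x => -((M : ℝ) + 1 / 2)⁻¹ * (x ^ (-((M : ℝ) + 1 / 2)) * halfPowRem (M + 1) x) with hF
  set F' : ℝ → ℝ := fun v => v ^ (-((M + 1 : ℕ) : ℝ) - 1 / 2) * halfPowRem (M + 1) v +
    v ^ (-(M : ℝ) - 1 / 2) * halfPowRem M v with hF'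
  have hi' : IntegrableOn F' (Set.Ioi 0) := hi
  have hcont : ContinuousAt F 1 :=
    ((Real.continuousAt_rpow_const 1 _ (Or.inl one_ne_zero)).mul
      (continuous_halfPowRem_succ M).continuousAt).const_mul _
  have hleft : ∫ v in (0 : ℝ)..1, F' v = F 1 - 0 := by
    refine intervalIntegral.integral_eq_sub_of_hasDerivAt_of_tendsto one_pos
      (fun x hx => hasDerivAt_rpow_mul_halfPowRem_succ M hx.1 hx.2.ne)
      ((intervalIntegrable_iff_integrableOn_Ioc_of_le zero_le_one).2
        (hi'.mono_set fun x hx => hx.1)) ?_ (hcont.tendsto.mono_left nhdsWithin_le_nhds)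
    simpa only [mul_zero] using (tendsto_rpow_mul_halfPowRem_succ_nhdsGT_zero M).const_mul
      (-((M : ℝ) + 1 / 2)⁻¹)
  have hright : ∫ v in Set.Ioi (1 : ℝ), F' v = 0 - F 1 := by
    refine integral_Ioi_of_hasDerivAt_of_tendsto hcont.continuousWithinAt
      (fun x hx => hasDerivAt_rpow_mul_halfPowRem_succ M (one_pos.trans hx) (ne_of_gt hx))
      (hi'.mono_set (Set.Ioi_subset_Ioi zero_le_one)) ?_
    simpa only [mul_zero] using (tendsto_rpow_mul_halfPowRem_succ_atTop M).const_mul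
      (-((M : ℝ) + 1 / 2)⁻¹)
  have hsum := intervalIntegral.integral_interval_add_Ioi hi'
    (hi'.mono_set (Set.Ioi_subset_Ioi zero_le_one))
  rw [hleft, hright, hF', integral_add (integrableOn_rpow_mul_halfPowRem (M + 1))
    (integrableOn_rpow_mul_halfPowRem M)] at hsum
  linarith

lemma integral_rpow_mul_halfPowRem (M : ℕ) :
    ∫ v in Set.Ioi (0 : ℝ), v ^ (-(M : ℝ) - 1 / 2) * halfPowRem M v =
      Real.Gamma (1 / 2 - (M : ℝ)) * Real.Gamma (M + 1 / 2) := by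
  induction M with
  | zero => exact integrableOn_and_integral_rpow_mul_halfPowRem_zero.2
  | succ M ih =>
    have hM : (0 : ℝ) ≤ M := Nat.cast_nonneg M
    have h1 := Real.Gamma_add_one (s := 1 / 2 - ((M + 1 : ℕ) : ℝ)) (by push_cast; linarith)
    have h2 := Real.Gamma_add_one (s := (M : ℝ) + 1 / 2) (by positivity)
    rw [integral_rpow_mul_halfPowRem_succ, ih,
      show ((M + 1 : ℕ) : ℝ) + 1 / 2 = (M : ℝ) + 1 / 2 + 1 by push_cast; ring, h2,
      show 1 / 2 - (M : ℝ) = 1 / 2 - ((M + 1 : ℕ) : ℝ) + 1 by push_cast; ring, h1]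
    push_cast
    ring

lemma integrableOn_and_integral_rpow_mul_halfPowRem_inv_sq (M : ℕ) :
    IntegrableOn (fun y : ℝ => y ^ (2 * (M : ℝ) - 2) * halfPowRem M (y⁻¹ ^ 2)) (Set.Ioi 0) ∧
    ∫ y in Set.Ioi (0 : ℝ), y ^ (2 * (M : ℝ) - 2) * halfPowRem M (y⁻¹ ^ 2) =
      1 / 2 * (Real.Gamma (1 / 2 - (M : ℝ)) * Real.Gamma (M + 1 / 2)) := by
  have hcongr : ∀ y ∈ Set.Ioi (0 : ℝ), (|(-2 : ℝ)| * y ^ ((-2 : ℝ) - 1)) •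
      ((y ^ (-2 : ℝ)) ^ (-(M : ℝ) - 1 / 2) * halfPowRem M (y ^ (-2 : ℝ))) =
      2 * (y ^ (2 * (M : ℝ) - 2) * halfPowRem M (y⁻¹ ^ 2)) := by
    intro y hy
    have hy0 : 0 < y := hy
    rw [← Real.rpow_mul hy0.le, smul_eq_mul,
      show y ^ (2 * (M : ℝ) - 2) = y ^ ((-2 : ℝ) - 1) * y ^ (-2 * (-(M : ℝ) - 1 / 2)) by
        rw [← Real.rpow_add hy0]
        ring_nf,
      show y⁻¹ ^ 2 = y ^ (-2 : ℝ) by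
        rw [Real.rpow_neg hy0.le, inv_pow]
        norm_cast, abs_neg, abs_two]
    ring
  have h := integrableOn_rpow_mul_halfPowRem M
  rw [← integrableOn_Ioi_comp_rpow_iff _ (by norm_num : (-2 : ℝ) ≠ 0),
    integrableOn_congr_fun hcongr measurableSet_Ioi] at h
  have h' := integral_rpow_mul_halfPowRem M
  rw [← integral_comp_rpow_Ioi _ (by norm_num : (-2 : ℝ) ≠ 0),
    setIntegral_congr_fun measurableSet_Ioi hcongr, integral_const_mul] at h'
  refine ⟨?_, by linarith⟩
  refine (h.const_mul (1 / 2)).congr (.of_forall fun y => ?_)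
  simp only
  ring

lemma integrableOn_and_integral_integral_halfPowRem_div_sq_mul (M : ℕ) {u : ℝ → ℝ}
    (hu : Measurable u)
    (hint : IntegrableOn (fun x => x ^ (2 * (M : ℝ) - 1) * u x) (Set.Ioi 0)) :
    IntegrableOn (fun s : ℝ => ∫ x in Set.Ioi 0,
      s ^ (2 * (M : ℝ) - 2) * halfPowRem M ((x / s) ^ 2) * u x) (Set.Ioi 0) ∧
    ∫ s in Set.Ioi (0 : ℝ), ∫ x in Set.Ioi 0,
      s ^ (2 * (M : ℝ) - 2) * halfPowRem M ((x / s) ^ 2) * u x =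
      1 / 2 * (Real.Gamma (1 / 2 - (M : ℝ)) * Real.Gamma (M + 1 / 2)) *
        ∫ x in Set.Ioi 0, x ^ (2 * (M : ℝ) - 1) * u x := by
  obtain ⟨hg, hgval⟩ := integrableOn_and_integral_rpow_mul_halfPowRem_inv_sq M
  set g : ℝ → ℝ := fun y => y ^ (2 * (M : ℝ) - 2) * halfPowRem M (y⁻¹ ^ 2) with hgdef
  have hslice : ∀ x ∈ Set.Ioi (0 : ℝ), ∀ s ∈ Set.Ioi (0 : ℝ),
      s ^ (2 * (M : ℝ) - 2) * halfPowRem M ((x / s) ^ 2) * u x =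
        x ^ (2 * (M : ℝ) - 2) * u x * g (s * x⁻¹) := by
    intro x hx s hs
    have hx0 : 0 < x := hx
    have hs0 : 0 < s := hs
    have hxp : x ^ (2 * (M : ℝ) - 2) ≠ 0 := (Real.rpow_pos_of_pos hx0 _).ne'
    simp only [hgdef]
    rw [Real.mul_rpow hs0.le (inv_nonneg.2 hx0.le), Real.inv_rpow hx0.le, mul_inv, inv_inv,
      show s⁻¹ * x = x / s by ring]
    field_simp
  have hpow : ∀ x ∈ Set.Ioi (0 : ℝ), x ^ (2 * (M : ℝ) - 1) = x ^ (2 * (M : ℝ) - 2) * x := by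
    intro x hx
    rw [← Real.rpow_add_one (ne_of_gt hx)]
    ring_nf
  have hscale : ∀ (f : ℝ → ℝ), ∀ x ∈ Set.Ioi (0 : ℝ),
      ∫ s in Set.Ioi 0, f (s * x⁻¹) = x * ∫ y in Set.Ioi 0, f y := by
    intro f x hx
    rw [integral_comp_mul_right_Ioi f 0 (inv_pos.2 hx), zero_mul, inv_inv, smul_eq_mul]
  have hmeas : Measurable (Function.uncurry fun s x : ℝ =>
      s ^ (2 * (M : ℝ) - 2) * halfPowRem M ((x / s) ^ 2) * u x) := by
    have := measurable_halfPowRem M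
    unfold Function.uncurry
    fun_prop
  have hprod : Integrable (Function.uncurry fun s x : ℝ =>
      s ^ (2 * (M : ℝ) - 2) * halfPowRem M ((x / s) ^ 2) * u x)
      ((volume.restrict (Set.Ioi 0)).prod (volume.restrict (Set.Ioi 0))) := by
    rw [integrable_prod_iff' hmeas.aestronglyMeasurable]
    constructor
    · refine (ae_restrict_iff' measurableSet_Ioi).2 (.of_forall fun x hx => ?_)
      refine IntegrableOn.congr_fun ?_ (fun s hs => (hslice x hx s hs).symm) measurableSet_Ioi
      refine Integrable.const_mul ?_ _
      exact (integrableOn_Ioi_comp_mul_right_iff g 0 (inv_pos.2 hx)).2 (by simpa using hg)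
    · refine IntegrableOn.congr_fun (hint.norm.mul_const (∫ y in Set.Ioi 0, ‖g y‖))
        (fun x hx => ?_) measurableSet_Ioi
      have hx0 : 0 < x := hx
      simp only [Function.uncurry]
      have hnorm : Set.EqOn
          (fun s => ‖s ^ (2 * (M : ℝ) - 2) * halfPowRem M ((x / s) ^ 2) * u x‖)
          (fun s => ‖x ^ (2 * (M : ℝ) - 2) * u x‖ * ‖g (s * x⁻¹)‖) (Set.Ioi 0) := fun s hs => by
        simp only
        rw [hslice x hx s hs, norm_mul]
      rw [setIntegral_congr_fun measurableSet_Ioi hnorm, integral_const_mul,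
        hscale (fun y => ‖g y‖) x hx, hpow x hx]
      simp only [norm_mul, Real.norm_of_nonneg hx0.le]
      ring
  refine ⟨hprod.integral_prod_left, ?_⟩
  rw [integral_integral_swap hprod, ← hgval, ← integral_const_mul]
  refine setIntegral_congr_fun measurableSet_Ioi fun x hx => ?_
  rw [setIntegral_congr_fun measurableSet_Ioi (fun s hs => hslice x hx s hs),
    integral_const_mul, hscale g x hx, hpow x hx]
  ring

lemma integrableOn_rpow_mul_of_le {u : ℝ → ℝ} (hu : Measurable u) {p β : ℝ} (hp : 0 ≤ p)
    (hpβ : p ≤ β) (h0 : IntegrableOn u (Set.Ioi 0))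
    (h1 : IntegrableOn (fun x => x ^ β * |u x|) (Set.Ioi 1)) :
    IntegrableOn (fun x => x ^ p * u x) (Set.Ioi 0) := by
  have hmeas : Measurable (fun x => x ^ p * u x) := by fun_prop
  rw [← Set.Ioc_union_Ioi_eq_Ioi zero_le_one]
  refine IntegrableOn.union ?_ ?_
  · refine (h0.mono_set fun x hx => hx.1).norm.mono' hmeas.aestronglyMeasurable
      ((ae_restrict_iff' measurableSet_Ioc).2 (.of_forall fun x hx => ?_))
    rw [norm_mul, Real.norm_of_nonneg (Real.rpow_nonneg hx.1.le _)]
    exact mul_le_of_le_one_left (norm_nonneg _) (Real.rpow_le_one hx.1.le hx.2 hp)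
  · refine h1.mono' hmeas.aestronglyMeasurable
      ((ae_restrict_iff' measurableSet_Ioi).2 (.of_forall fun x hx => ?_))
    have hx1 : 1 < x := hx
    rw [norm_mul, Real.norm_of_nonneg (Real.rpow_nonneg (by linarith) _), Real.norm_eq_abs]
    exact mul_le_mul_of_nonneg_right (Real.rpow_le_rpow_of_exponent_le hx1.le hpβ)
      (abs_nonneg _)

lemma integral_max_rpow_mul_eq_integral_halfPowRem_mul (M : ℕ) (hM : 1 ≤ M) {u : ℝ → ℝ}
    (h0 : IntegrableOn u (Set.Ioi 0))
    (hint : ∀ j < M, IntegrableOn (fun x => x ^ (2 * (j : ℝ)) * u x) (Set.Ioi 0))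
    (hmom : ∀ j < M, ∫ x in Set.Ioi 0, x ^ (2 * (j : ℝ)) * u x = 0) (s : ℝ) :
    ∫ x in Set.Ioi 0, max (1 - (x / s) ^ 2) 0 ^ ((M : ℝ) - 1 / 2) * u x =
      ∫ x in Set.Ioi 0, halfPowRem M ((x / s) ^ 2) * u x := by
  have hM' : (1 : ℝ) ≤ M := by exact_mod_cast hM
  have hterm : ∀ j, Set.EqOn
      (fun x => halfBinomCoeff M j * (s⁻¹ ^ (2 * j)) * (x ^ (2 * (j : ℝ)) * u x))
      (fun x => halfBinomCoeff M j * ((x / s) ^ 2) ^ j * u x) (Set.Ioi 0) := by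
    intro j x _
    have hx : x ^ (2 * (j : ℝ)) = x ^ (2 * j) := by exact_mod_cast Real.rpow_natCast x (2 * j)
    simp only
    rw [hx, ← pow_mul, div_eq_mul_inv, mul_pow]
    ring
  have hterm_int : ∀ j ∈ Finset.range M, IntegrableOn
      (fun x => halfBinomCoeff M j * ((x / s) ^ 2) ^ j * u x) (Set.Ioi 0) := fun j hj =>
    IntegrableOn.congr_fun ((hint j (Finset.mem_range.1 hj)).const_mul _) (hterm j)
      measurableSet_Ioi
  have hmax : IntegrableOn
      (fun x => max (1 - (x / s) ^ 2) 0 ^ ((M : ℝ) - 1 / 2) * u x) (Set.Ioi 0) := by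
    refine Integrable.bdd_mul (c := 1) h0
      (Measurable.aestronglyMeasurable (by fun_prop)) (.of_forall fun x => ?_)
    rw [Real.norm_of_nonneg (by positivity)]
    refine Real.rpow_le_one (le_max_right _ _) (max_le ?_ zero_le_one) (by linarith)
    linarith [sq_nonneg (x / s)]
  have hsum : ∫ x in Set.Ioi 0, ∑ j ∈ Finset.range M,
      halfBinomCoeff M j * ((x / s) ^ 2) ^ j * u x = 0 := by
    rw [integral_finsetSum _ hterm_int]
    refine Finset.sum_eq_zero fun j hj => ?_
    rw [← setIntegral_congr_fun measurableSet_Ioi (hterm j), integral_const_mul,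
      hmom j (Finset.mem_range.1 hj), mul_zero]
  simp only [halfPowRem, sub_mul, Finset.sum_mul]
  rw [integral_sub hmax (integrable_finsetSum _ hterm_int), hsum, sub_zero]

lemma integral_Ioo_sq_sub_rpow_mul_eq {a : ℝ} (ha : 0 < a) (f : ℝ → ℝ) {s : ℝ} (hs : 0 < s) :
    ∫ r in Set.Ioo 0 (s ^ 2), (s ^ 2 - r) ^ a * f r =
      s ^ (2 * a) * ∫ x in Set.Ioi 0, max (1 - (x / s) ^ 2) 0 ^ a * (2 * x * f (x ^ 2)) := by
  have hIoi : ∫ r in Set.Ioo 0 (s ^ 2), (s ^ 2 - r) ^ a * f r =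
      ∫ r in Set.Ioi 0, max (s ^ 2 - r) 0 ^ a * f r := by
    rw [setIntegral_eq_of_subset_of_forall_sdiff_eq_zero (s := Set.Ioo 0 (s ^ 2))
      measurableSet_Ioi (fun x hx => hx.1)]
    · refine setIntegral_congr_fun measurableSet_Ioo fun r hr => ?_
      rw [max_eq_left (by linarith [hr.2])]
    · intro r hr
      have : s ^ 2 ≤ r := by
        by_contra! h
        exact hr.2 ⟨hr.1, h⟩
      rw [max_eq_right (by linarith), Real.zero_rpow ha.ne', zero_mul]
  rw [hIoi, ← integral_comp_rpow_Ioi_of_pos two_pos, ← integral_const_mul]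
  refine setIntegral_congr_fun measurableSet_Ioi fun x hx => ?_
  have h1 : max (s ^ 2 - x ^ 2) 0 = s ^ 2 * max (1 - (x / s) ^ 2) 0 := by
    rw [mul_max_of_nonneg _ _ (sq_nonneg s)]
    congr 1
    · field_simp
    · simp
  have h2 : (s ^ 2) ^ a = s ^ (2 * a) := by
    rw [Real.rpow_mul hs.le, Real.rpow_two]
  simp only [Real.rpow_two, smul_eq_mul]
  rw [h1, Real.mul_rpow (sq_nonneg s) (le_max_right _ _), h2,
    show (2 : ℝ) - 1 = 1 by norm_num, Real.rpow_one]
  ring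

/-- Reconstruction constant, odd case: for `k` odd and an admissible `w`,
`∫₀^∞ λ(s) ds = Γ(-k/2) ∫₀^∞ s^{n-1} w(s) ds`, where
`λ(s) = (1/(s Γ(k/2+1))) ∫₀^{s²} (s²-r)^{k/2} w̃(r) dr` and
`w̃(s) = s^{(n-k)/2-1} w(√s)`. -/
theorem stmt_15 (n k : ℕ) (hk : 1 ≤ k) (hkn : k < n) (hodd : Odd k)
    (w : ℝ → ℝ) (hw : Measurable w)
    (hI0 : IntegrableOn (fun s => s ^ ((n : ℝ) - k - 1) * |w s|) (Set.Ioi 0))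
    (β : ℝ) (hβ : (k : ℝ) < β)
    (hIβ : IntegrableOn (fun s => s ^ (β + (n : ℝ) - k - 1) * |w s|) (Set.Ioi 1))
    (hmom : ∀ j : ℕ, 2 * j ≤ k →
      ∫ s in Set.Ioi 0, s ^ (2 * (j : ℝ) + n - k - 1) * w s = 0)
    (wt lam : ℝ → ℝ)
    (hwt : ∀ s : ℝ, wt s = s ^ (((n : ℝ) - k) / 2 - 1) * w (Real.sqrt s))
    (hlam : ∀ s : ℝ, 0 < s → lam s =
      1 / (s * Real.Gamma ((k : ℝ) / 2 + 1)) *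
        ∫ r in Set.Ioo 0 (s ^ 2), (s ^ 2 - r) ^ ((k : ℝ) / 2) * wt r) :
    IntegrableOn lam (Set.Ioi 0) ∧
    ∫ s in Set.Ioi 0, lam s
      = Real.Gamma (-(k : ℝ) / 2) * ∫ s in Set.Ioi 0, s ^ ((n : ℝ) - 1) * w s := by
  obtain ⟨m, hm⟩ := hodd
  set M : ℕ := m + 1 with hMdef
  have hkM : (k : ℝ) = 2 * M - 1 := by
    rw [hm, hMdef]
    push_cast
    ring
  have hk0 : (0 : ℝ) < k := by exact_mod_cast hk
  set u : ℝ → ℝ := fun x => x ^ ((n : ℝ) - k - 1) * w x with hu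
  have hum : Measurable u := by fun_prop
  have hmulpow : ∀ p : ℝ, ∀ x ∈ Set.Ioi (0 : ℝ),
      x ^ p * u x = x ^ (p + n - k - 1) * w x := by
    intro p x hx
    simp only [hu]
    rw [← mul_assoc, ← Real.rpow_add hx]
    ring_nf
  have habs : ∀ x ∈ Set.Ioi (0 : ℝ), |u x| = x ^ ((n : ℝ) - k - 1) * |w x| := fun x hx => by
    rw [hu, abs_mul, abs_of_nonneg (Real.rpow_nonneg (le_of_lt hx) _)]
  have hu0 : IntegrableOn u (Set.Ioi 0) :=
    (integrable_norm_iff hum.aestronglyMeasurable).1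
      (hI0.congr_fun (fun x hx => (habs x hx).symm) measurableSet_Ioi)
  have huβ : IntegrableOn (fun x => x ^ β * |u x|) (Set.Ioi 1) := by
    refine hIβ.congr_fun (fun x hx => ?_) measurableSet_Ioi
    have hx0 : x ∈ Set.Ioi (0 : ℝ) := Set.mem_Ioi.2 (one_pos.trans (Set.mem_Ioi.1 hx))
    simp only
    rw [habs x hx0, ← mul_assoc, ← Real.rpow_add hx0]
    ring_nf
  have hjk : ∀ j < M, 2 * j ≤ k := fun j hj => by omega
  have huint : ∀ j < M, IntegrableOn (fun x => x ^ (2 * (j : ℝ)) * u x) (Set.Ioi 0) := by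
    intro j hj
    have : (2 * (j : ℝ)) ≤ k := by exact_mod_cast hjk j hj
    exact integrableOn_rpow_mul_of_le hum (by positivity) (by linarith) hu0 huβ
  have humom : ∀ j < M, ∫ x in Set.Ioi 0, x ^ (2 * (j : ℝ)) * u x = 0 := by
    intro j hj
    rw [setIntegral_congr_fun measurableSet_Ioi (hmulpow _), hmom j (hjk j hj)]
  have huk : IntegrableOn (fun x => x ^ (2 * (M : ℝ) - 1) * u x) (Set.Ioi 0) := by
    rw [← hkM]
    exact integrableOn_rpow_mul_of_le hum hk0.le hβ.le hu0 huβ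
  obtain ⟨hint, hval⟩ := integrableOn_and_integral_integral_halfPowRem_div_sq_mul M hum huk
  have hlam' : ∀ s ∈ Set.Ioi (0 : ℝ), 2 / Real.Gamma ((k : ℝ) / 2 + 1) *
      (∫ x in Set.Ioi 0, s ^ (2 * (M : ℝ) - 2) * halfPowRem M ((x / s) ^ 2) * u x) = lam s := by
    intro s hs
    have hs0 : 0 < s := hs
    have hwtu : ∀ x ∈ Set.Ioi (0 : ℝ),
        max (1 - (x / s) ^ 2) 0 ^ ((k : ℝ) / 2) * (2 * x * wt (x ^ 2)) =
        2 * (max (1 - (x / s) ^ 2) 0 ^ ((M : ℝ) - 1 / 2) * u x) := by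
      intro x hx
      have hx0 : 0 < x := hx
      have hsq : (x ^ 2) ^ (((n : ℝ) - k) / 2 - 1) = x ^ (2 * (((n : ℝ) - k) / 2 - 1)) := by
        rw [Real.rpow_mul hx0.le, Real.rpow_two]
      rw [hwt, Real.sqrt_sq hx0.le, hsq,
        show (k : ℝ) / 2 = M - 1 / 2 by rw [hkM]; ring, hu]
      have : x ^ ((n : ℝ) - k - 1) = x ^ (2 * (((n : ℝ) - k) / 2 - 1)) * x := by
        rw [← Real.rpow_add_one hx0.ne']
        ring_nf
      simp only [this]
      ring
    have hspow : s ^ (2 * (M : ℝ) - 2) = s ^ (2 * ((k : ℝ) / 2)) / s := by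
      rw [← Real.rpow_sub_one hs0.ne', hkM]
      ring_nf
    rw [hlam s hs, integral_Ioo_sq_sub_rpow_mul_eq (by positivity) wt hs0,
      setIntegral_congr_fun measurableSet_Ioi hwtu, integral_const_mul,
      integral_max_rpow_mul_eq_integral_halfPowRem_mul M (by omega) hu0 huint humom s]
    simp only [mul_assoc]
    rw [integral_const_mul, hspow]
    ring
  refine ⟨IntegrableOn.congr_fun (hint.const_mul _) hlam' measurableSet_Ioi, ?_⟩
  rw [← setIntegral_congr_fun measurableSet_Ioi hlam', integral_const_mul, hval, hkM.symm,
    setIntegral_congr_fun measurableSet_Ioi (hmulpow k),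
    show (1 / 2 : ℝ) - M = -(k : ℝ) / 2 by rw [hkM]; ring,
    show (M : ℝ) + 1 / 2 = (k : ℝ) / 2 + 1 by rw [hkM]; ring,
    show (k : ℝ) + n - k - 1 = n - 1 by ring]
  have hΓ : Real.Gamma ((k : ℝ) / 2 + 1) ≠ 0 := (Real.Gamma_pos_of_pos (by positivity)).ne'
  field_simp
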